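/- Let (S, T, 𝒫) be a setting with 𝒫 = {P_1, …, P_k}, let c ≥ 0 be an integer, and let F ⊆ F_0 be c-jumping and 2c-separated. Let H be the graph obtained from U𝒫 by adding the vertices of (S ∪ T) \ V𝒫 as vertices, and the pairs in F as edges. Then there exist k+1 pairwise vertex-disjoint S–T paths in H such that no two of them are joined by a path of U𝒫 of length at most c. -/

import Mathlib

open SimpleGraph

/-- The distance in a graph `G` between two sets of vertices (`⊤` if no connecting walk). -/
noncomputable def eSetDist {V : Type*} (G : SimpleGraph V) (A B : Set V) : ℕ∞ :=
  sInf {n : ℕ∞ | ∃ (a b : V) (w : G.Walk a b), a ∈ A ∧ b ∈ B ∧ (w.length : ℕ∞) = n}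

/-- A *setting* `(S, T, 𝒫)`: a graph `G`, disjoint sets `S, T` of vertices, and a family
`𝒫 = {P 0, …, P (k-1)}` of `k` pairwise vertex-disjoint `S`–`T` paths, each with no
internal vertex in `S ∪ T`. -/
structure Setting (V : Type) [DecidableEq V] (k : ℕ) where
  G : SimpleGraph V
  S : Set V
  T : Set V
  disjST : Disjoint S T
  sv : Fin k → V
  tv : Fin k → V
  P : ∀ h : Fin k, G.Walk (sv h) (tv h)
  sv_mem : ∀ h, sv h ∈ S
  tv_mem : ∀ h, tv h ∈ T
  isPath : ∀ h, (P h).IsPath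
  disjP : ∀ h h' : Fin k, h ≠ h' → ∀ x : V, x ∈ (P h).support → x ∉ (P h').support
  internal : ∀ h : Fin k, ∀ x ∈ (P h).support, x ∈ S ∪ T → x = sv h ∨ x = tv h

namespace Setting

variable {V : Type} [DecidableEq V] {k : ℕ} (M : Setting V k)

/-- `V𝒫`, the set of vertices of the paths of the setting. -/
def VP : Set V := {x | ∃ h : Fin k, x ∈ (M.P h).support}

/-- `F₀`: ordered pairs of distinct vertices of `V𝒫 ∪ S ∪ T`. -/
def F0 : Set (V × V) :=
  {p | p.1 ≠ p.2 ∧ p.1 ∈ M.VP ∪ M.S ∪ M.T ∧ p.2 ∈ M.VP ∪ M.S ∪ M.T}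

/-- The position of a vertex along the path `P h` (used to express "earlier/later":
`u` is earlier than `v` in `P h` iff both lie on `P h` and `idx h u < idx h v`;
the subpath of `P h` between `u` and `v` has length `idx h v - idx h u`). -/
def idx (h : Fin k) (x : V) : ℕ := (M.P h).support.idxOf x

/-- A `c`-barrier, described by the two ends `α h`, `β h` of each subpath `Q h` of `P h`:
each `Q h` has length `idx h (β h) - idx h (α h) ≤ c`. -/
def IsBarrier (c : ℕ) (α β : Fin k → V) : Prop :=
  ∀ h : Fin k, α h ∈ (M.P h).support ∧ β h ∈ (M.P h).support ∧
    M.idx h (α h) ≤ M.idx h (β h) ∧ M.idx h (β h) - M.idx h (α h) ≤ c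

/-- Membership in the vertex set `V(Q 0 ∪ ⋯ ∪ Q (k-1))` of a barrier. -/
def InBarrier (α β : Fin k → V) (x : V) : Prop :=
  ∃ h : Fin k, x ∈ (M.P h).support ∧ M.idx h (α h) ≤ M.idx h x ∧ M.idx h x ≤ M.idx h (β h)

/-- The pair `p = (a, b)` jumps the barrier `(α, β)`. -/
def Jumps (α β : Fin k → V) (p : V × V) : Prop :=
  ¬ M.InBarrier α β p.1 ∧ ¬ M.InBarrier α β p.2 ∧
  (p.1 ∈ M.S \ M.VP ∨ ∃ h : Fin k, p.1 ∈ (M.P h).support ∧ M.idx h p.1 < M.idx h (α h)) ∧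
  (p.2 ∈ M.T \ M.VP ∨ ∃ h : Fin k, p.2 ∈ (M.P h).support ∧ M.idx h (β h) < M.idx h p.2)

/-- `F` is `c`-jumping: every `c`-barrier is jumped by some member of `F`. -/
def Jumping (c : ℕ) (F : Set (V × V)) : Prop :=
  ∀ α β : Fin k → V, M.IsBarrier c α β → ∃ p ∈ F, M.Jumps α β p

/-- `ab 0, …, ab (n-1)` is a `c`-augmenting sequence. -/
def IsAugSeq (c : ℕ) {n : ℕ} (ab : Fin n → V × V) : Prop :=
  ∃ hn : 0 < n,
    (∀ i, ab i ∈ M.F0) ∧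
    (ab ⟨0, hn⟩).1 ∈ M.S \ M.VP ∧
    (ab ⟨n - 1, Nat.sub_lt hn Nat.one_pos⟩).2 ∈ M.T \ M.VP ∧
    ∀ (i : ℕ) (hi : i + 1 < n), ∃ h : Fin k,
      (ab ⟨i, Nat.lt_of_succ_lt hi⟩).2 ∈ (M.P h).support ∧
      (ab ⟨i + 1, hi⟩).1 ∈ (M.P h).support ∧
      M.idx h (ab ⟨i + 1, hi⟩).1 < M.idx h (ab ⟨i, Nat.lt_of_succ_lt hi⟩).2 ∧
      c + 1 ≤ M.idx h (ab ⟨i, Nat.lt_of_succ_lt hi⟩).2 - M.idx h (ab ⟨i + 1, hi⟩).1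

/-- `U𝒫`, the union `P 0 ∪ ⋯ ∪ P (k-1)` as a graph on `V`. -/
def UP : SimpleGraph V := ⨆ h : Fin k, ((M.P h).toSubgraph).spanningCoe

open Classical in
/-- `dist_{U𝒫}(u, v)`: the distance between `u` and `v` in `U𝒫`, taken to be `⊤` if `u`
or `v` is not in `V𝒫` or they lie in different components of `U𝒫`. -/
noncomputable def pdist (u v : V) : ℕ∞ :=
  if u ∈ M.VP ∧ v ∈ M.VP then eSetDist M.UP {u} {v} else ⊤

/-- `D` is `ℓ`-separated. -/
def Separated (ℓ : ℕ) (D : Set (V × V)) : Prop :=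
  ∀ p ∈ D, ∀ q ∈ D, p ≠ q →
    (ℓ : ℕ∞) < M.pdist p.1 q.1 ∧ (ℓ : ℕ∞) < M.pdist p.2 q.2

end Setting


theorem gp_reach_unique {E : Type*} (R : E → E → Prop)
    (hR : ∀ a b x, R a x → R b x → a = b) {s s' : E}
    (hs : ∀ a, ¬ R a s) (hs' : ∀ a, ¬ R a s') {x : E}
    (h : Relation.ReflTransGen R s x) (h' : Relation.ReflTransGen R s' x) : s = s' := by
  induction h with
  | refl =>
    cases h' with
    | refl => rfl
    | tail _ hb => exact absurd hb (hs _)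
  | tail _ hb ih =>
    cases h' with
    | refl => exact absurd hb (hs' _)
    | tail h1 hb' =>
      have := hR _ _ _ hb hb'
      subst this
      exact ih h1

theorem gp_reach_end {E : Type*} [Finite E] (R : E → E → Prop)
    (hR : ∀ a b x, R a x → R b x → a = b) {s : E} (hs : ∀ a, ¬ R a s) :
    ∃ e, Relation.ReflTransGen R s e ∧ ∀ x, ¬ R e x := by
  by_contra hcon
  push Not at hcon
  choose g hg using hcon
  let φ : {e // Relation.ReflTransGen R s e} → {e // Relation.ReflTransGen R s e} :=
    fun e => ⟨g e.1 e.2, e.2.tail (hg e.1 e.2)⟩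
  have hinj : Function.Injective φ := by
    rintro ⟨a, ha⟩ ⟨b, hb⟩ hab
    have h1 : g a ha = g b hb := congrArg Subtype.val hab
    have h2 := hg a ha
    rw [h1] at h2
    exact Subtype.ext (hR _ _ _ h2 (hg b hb))
  have hsurj := Finite.injective_iff_surjective.mp hinj
  obtain ⟨⟨a, ha⟩, h1⟩ := hsurj ⟨s, .refl⟩
  have h2 : g a ha = s := congrArg Subtype.val h1
  exact hs a (h2 ▸ hg a ha)

/-- Abstract assembly of paths out of pieces. -/
theorem gp_assemble {V : Type} [DecidableEq V] {E : Type} [Finite E] (U H : SimpleGraph V)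
    (c : ℕ) (S T : Set V) (R : E → E → Prop) (piece : E → Set V) (ent : E → V)
    (k : ℕ) (st : Fin (k + 1) → E) (hinj : Function.Injective st)
    (hR : ∀ a b x, R a x → R b x → a = b) (hst : ∀ i a, ¬ R a (st i))
    (hS : ∀ i, ent (st i) ∈ S) (hent : ∀ e, ent e ∈ piece e)
    (hstep : ∀ e e', R e e' → ∃ w : H.Walk (ent e) (ent e'),
      ∀ x ∈ w.support, x ∈ piece e ∨ x ∈ piece e')
    (hend : ∀ e, (∀ x, ¬ R e x) → ∃ t ∈ T, ∃ w : H.Walk (ent e) t, ∀ x ∈ w.support, x ∈ piece e)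
    (hsep : ∀ e e', e ≠ e' → ∀ u ∈ piece e, ∀ v ∈ piece e', ∀ w : U.Walk u v, c < w.length) :
    ∃ (u v : Fin (k + 1) → V) (Z : ∀ i, H.Walk (u i) (v i)),
      (∀ i, (Z i).IsPath) ∧ (∀ i, u i ∈ S) ∧ (∀ i, v i ∈ T) ∧
      (∀ i j, i ≠ j → ∀ x, x ∈ (Z i).support → x ∉ (Z j).support) ∧
      (∀ i j, i ≠ j →
        (c : ℕ∞) < eSetDist U {x | x ∈ (Z i).support} {x | x ∈ (Z j).support}) := by
  have hwalk : ∀ s e, Relation.ReflTransGen R s e → ∃ w : H.Walk (ent s) (ent e),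
      ∀ x ∈ w.support, ∃ e', Relation.ReflTransGen R s e' ∧ x ∈ piece e' := by
    intro s e h
    induction h with
    | refl =>
      refine ⟨.nil, ?_⟩
      intro x hx
      simp at hx
      exact ⟨s, .refl, hx ▸ hent s⟩
    | tail h1 h2 ih =>
      obtain ⟨w, hw⟩ := ih
      obtain ⟨w', hw'⟩ := hstep _ _ h2
      refine ⟨w.append w', ?_⟩
      intro x hx
      rw [SimpleGraph.Walk.mem_support_append_iff] at hx
      rcases hx with hx | hx
      · exact hw x hx
      · rcases hw' x hx with hx | hx
        · exact ⟨_, h1, hx⟩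
        · exact ⟨_, h1.tail h2, hx⟩
  have hfull : ∀ i, ∃ t ∈ T, ∃ w : H.Walk (ent (st i)) t, w.IsPath ∧
      ∀ x ∈ w.support, ∃ e', Relation.ReflTransGen R (st i) e' ∧ x ∈ piece e' := by
    intro i
    obtain ⟨e, he, hno⟩ := gp_reach_end R hR (hst i)
    obtain ⟨w, hw⟩ := hwalk _ _ he
    obtain ⟨t, ht, w', hw'⟩ := hend e hno
    refine ⟨t, ht, (w.append w').bypass, SimpleGraph.Walk.bypass_isPath _, ?_⟩
    intro x hx
    have hx := SimpleGraph.Walk.support_bypass_subset_support _ hx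
    rw [SimpleGraph.Walk.mem_support_append_iff] at hx
    rcases hx with hx | hx
    · exact hw x hx
    · exact ⟨e, he, hw' x hx⟩
  choose v hv Z hZ hZs using hfull
  have key : ∀ i j, i ≠ j → ∀ x ∈ (Z i).support, ∀ y ∈ (Z j).support, ∀ w : U.Walk x y,
      c < w.length := by
    intro i j hij x hx y hy w
    obtain ⟨e, he, hxe⟩ := hZs i x hx
    obtain ⟨e', he', hye⟩ := hZs j y hy
    refine hsep e e' ?_ x hxe y hye w
    rintro rfl
    exact hij (hinj (gp_reach_unique R hR (hst i) (hst j) he he'))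
  refine ⟨fun i => ent (st i), v, Z, hZ, hS, hv, ?_, ?_⟩
  · intro i j hij x hx hx'
    have := key i j hij x hx x hx' .nil
    simp at this
  · intro i j hij
    have : ((c + 1 : ℕ) : ℕ∞) ≤
        eSetDist U {x | x ∈ (Z i).support} {x | x ∈ (Z j).support} := by
      apply le_sInf
      rintro _ ⟨a, b, w, ha, hb, rfl⟩
      exact_mod_cast key i j hij a ha b hb w
    refine lt_of_lt_of_le ?_ this
    exact_mod_cast Nat.lt_succ_self c

namespace Setting

variable {V : Type} [DecidableEq V] {k : ℕ} (M : Setting V k)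

theorem idx_getVert (h : Fin k) (i : ℕ) (hi : i ≤ (M.P h).length) :
    M.idx h ((M.P h).getVert i) = i := by
  unfold idx
  rw [SimpleGraph.Walk.getVert_eq_support_getElem _ hi]
  exact List.Nodup.idxOf_getElem (M.isPath h).support_nodup _ _

theorem idx_le (h : Fin k) {x : V} (hx : x ∈ (M.P h).support) :
    M.idx h x ≤ (M.P h).length := by
  have := List.idxOf_lt_length_iff.mpr hx
  rw [SimpleGraph.Walk.length_support] at this
  unfold idx
  omega

theorem getVert_idx (h : Fin k) {x : V} (hx : x ∈ (M.P h).support) :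
    (M.P h).getVert (M.idx h x) = x := by
  rw [SimpleGraph.Walk.getVert_eq_support_getElem _ (M.idx_le h hx)]
  exact List.getElem_idxOf _

theorem idx_sv (h : Fin k) : M.idx h (M.sv h) = 0 := by
  have := M.idx_getVert h 0 (Nat.zero_le _)
  simpa using this

theorem idx_tv (h : Fin k) : M.idx h (M.tv h) = (M.P h).length := by
  have := M.idx_getVert h (M.P h).length le_rfl
  simpa using this

theorem uniq {h h' : Fin k} {x : V} (hx : x ∈ (M.P h).support) (hx' : x ∈ (M.P h').support) :
    h = h' := by
  by_contra hne
  exact M.disjP h h' hne x hx hx'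

theorem UP_adj {u v : V} (huv : M.UP.Adj u v) : ∃ h, u ∈ (M.P h).support ∧
    v ∈ (M.P h).support ∧ M.idx h u ≤ M.idx h v + 1 ∧ M.idx h v ≤ M.idx h u + 1 := by
  unfold UP at huv
  simp only [SimpleGraph.iSup_adj, SimpleGraph.Subgraph.spanningCoe_adj] at huv
  obtain ⟨h, hh⟩ := huv
  refine ⟨h, ?_, ?_, ?_⟩
  · rw [← SimpleGraph.Walk.mem_verts_toSubgraph]; exact hh.fst_mem
  · rw [← SimpleGraph.Walk.mem_verts_toSubgraph]; exact hh.snd_mem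
  · rw [SimpleGraph.Walk.toSubgraph_adj_iff] at hh
    obtain ⟨i, hi, hlt⟩ := hh
    have e1 := M.idx_getVert h i (by omega)
    have e2 := M.idx_getVert h (i + 1) (by omega)
    rw [Sym2.eq_iff] at hi
    rcases hi with ⟨h1, h2⟩ | ⟨h1, h2⟩ <;> rw [h1] at e1 <;> rw [h2] at e2 <;> omega

theorem UP_walk_off {u v : V} (w : M.UP.Walk u v) (hu : u ∉ M.VP) : v = u := by
  cases w with
  | nil => rfl
  | cons hadj _ =>
    obtain ⟨h, h1, _⟩ := M.UP_adj hadj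
    exact absurd ⟨h, h1⟩ hu

theorem UP_walk_on {u v : V} (w : M.UP.Walk u v) {h : Fin k} (hu : u ∈ (M.P h).support) :
    v ∈ (M.P h).support ∧ M.idx h u ≤ M.idx h v + w.length ∧
      M.idx h v ≤ M.idx h u + w.length := by
  induction w with
  | nil => exact ⟨hu, by simp, by simp⟩
  | cons hadj w ih =>
    obtain ⟨h', h1, h2, h3, h4⟩ := M.UP_adj hadj
    obtain rfl := M.uniq hu h1
    obtain ⟨i1, i2, i3⟩ := ih h2
    refine ⟨i1, ?_, ?_⟩ <;> rw [SimpleGraph.Walk.length_cons] <;> omega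

theorem UP_walk_aux (h : Fin k) (d i : ℕ) (hi : i + d ≤ (M.P h).length) :
    ∃ w : M.UP.Walk ((M.P h).getVert i) ((M.P h).getVert (i + d)), w.length = d ∧
      ∀ x ∈ w.support, x ∈ (M.P h).support ∧ i ≤ M.idx h x ∧ M.idx h x ≤ i + d := by
  induction d with
  | zero =>
    refine ⟨.nil, rfl, ?_⟩
    intro x hx
    simp at hx
    subst hx
    have := M.idx_getVert h i (by omega)
    exact ⟨SimpleGraph.Walk.getVert_mem_support _ _, by omega, by omega⟩
  | succ d ih =>
    obtain ⟨w, hl, hw⟩ := ih (by omega)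
    have hadj : M.UP.Adj ((M.P h).getVert (i + d)) ((M.P h).getVert (i + (d + 1))) := by
      unfold UP
      simp only [SimpleGraph.iSup_adj, SimpleGraph.Subgraph.spanningCoe_adj]
      exact ⟨h, (SimpleGraph.Walk.toSubgraph_adj_getVert _ (by omega))⟩
    refine ⟨w.concat hadj, by simp [hl], ?_⟩
    intro x hx
    rw [SimpleGraph.Walk.support_concat] at hx
    simp at hx
    rcases hx with hx | hx
    · have := hw x hx
      exact ⟨this.1, this.2.1, by omega⟩
    · subst hx
      have := M.idx_getVert h (i + (d + 1)) (by omega)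
      exact ⟨SimpleGraph.Walk.getVert_mem_support _ _, by omega, by omega⟩

theorem UP_walk_le (h : Fin k) {u v : V} (hu : u ∈ (M.P h).support)
    (hv : v ∈ (M.P h).support) (huv : M.idx h u ≤ M.idx h v) :
    ∃ w : M.UP.Walk u v, w.length = M.idx h v - M.idx h u ∧
      ∀ x ∈ w.support, x ∈ (M.P h).support ∧ M.idx h u ≤ M.idx h x ∧ M.idx h x ≤ M.idx h v := by
  have hle := M.idx_le h hv
  obtain ⟨w, hl, hw⟩ := M.UP_walk_aux h (M.idx h v - M.idx h u) (M.idx h u) (by omega)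
  have e : M.idx h u + (M.idx h v - M.idx h u) = M.idx h v := by omega
  have e2 : (M.P h).getVert (M.idx h u + (M.idx h v - M.idx h u)) = v := by
    rw [e, M.getVert_idx h hv]
  refine ⟨w.copy (M.getVert_idx h hu) e2, by simpa using hl, ?_⟩
  intro x hx
  rw [SimpleGraph.Walk.support_copy] at hx
  rw [← e]
  exact hw x hx

theorem UP_walk (h : Fin k) {u v : V} (hu : u ∈ (M.P h).support) (hv : v ∈ (M.P h).support) :
    ∃ w : M.UP.Walk u v, ∀ x ∈ w.support, x ∈ (M.P h).support ∧
      min (M.idx h u) (M.idx h v) ≤ M.idx h x ∧ M.idx h x ≤ max (M.idx h u) (M.idx h v) := by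
  rcases le_total (M.idx h u) (M.idx h v) with hle | hle
  · obtain ⟨w, -, hw⟩ := M.UP_walk_le h hu hv hle
    refine ⟨w, fun x hx => ?_⟩
    have := hw x hx
    exact ⟨this.1, by omega, by omega⟩
  · obtain ⟨w, -, hw⟩ := M.UP_walk_le h hv hu hle
    refine ⟨w.reverse, fun x hx => ?_⟩
    rw [SimpleGraph.Walk.support_reverse, List.mem_reverse] at hx
    have := hw x hx
    exact ⟨this.1, by omega, by omega⟩

theorem pdist_far (h : Fin k) {u v : V} (hu : u ∈ (M.P h).support)
    (hv : v ∈ (M.P h).support) (ℓ : ℕ) (hd : (ℓ : ℕ∞) < M.pdist u v)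
    (huv : M.idx h u ≤ M.idx h v) : M.idx h u + ℓ < M.idx h v := by
  obtain ⟨w, hl, -⟩ := M.UP_walk_le h hu hv huv
  unfold pdist at hd
  rw [if_pos ⟨⟨h, hu⟩, ⟨h, hv⟩⟩] at hd
  have h1 : eSetDist M.UP {u} {v} ≤ (w.length : ℕ∞) := sInf_le ⟨u, v, w, rfl, rfl, rfl⟩
  have h2 : (ℓ : ℕ∞) < (w.length : ℕ∞) := lt_of_lt_of_le hd h1
  have h3 : ℓ < w.length := by exact_mod_cast h2
  omega

/-- Reachability by an augmenting sequence of `n + 1` pairs of `F`. -/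
def GReach (c : ℕ) (F : Set (V × V)) : ℕ → V × V → Prop
  | 0, p => p ∈ F ∧ p.1 ∈ M.S \ M.VP
  | n + 1, q => q ∈ F ∧ ∃ p, GReach c F n p ∧ ∃ h, p.2 ∈ (M.P h).support ∧
      q.1 ∈ (M.P h).support ∧ M.idx h q.1 + c + 1 ≤ M.idx h p.2

theorem exists_reach (c : ℕ) (F : Set (V × V)) (hjump : M.Jumping c F) :
    ∃ n p, M.GReach c F n p ∧ p.2 ∈ M.T \ M.VP := by
  classical
  by_contra hcon
  push Not at hcon
  have hm : ∀ h, ∃ m ≤ (M.P h).length, (m ≠ 0 → ∃ n p, M.GReach c F n p ∧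
      p.2 ∈ (M.P h).support ∧ M.idx h p.2 = m) ∧
      ∀ n p, M.GReach c F n p → p.2 ∈ (M.P h).support → M.idx h p.2 ≤ m := by
    intro h
    let Pr : ℕ → Prop := fun m => m = 0 ∨ ∃ n p, M.GReach c F n p ∧
      p.2 ∈ (M.P h).support ∧ M.idx h p.2 = m
    let m := Nat.findGreatest Pr (M.P h).length
    have hPm : Pr m := Nat.findGreatest_spec (P := Pr) (Nat.zero_le _) (Or.inl rfl)
    refine ⟨m, Nat.findGreatest_le _, ?_, ?_⟩
    · intro h0
      exact hPm.resolve_left h0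
    · intro n p hp hs
      exact Nat.le_findGreatest (M.idx_le h hs) (Or.inr ⟨n, p, hp, hs, rfl⟩)
  choose m hml hm0 hmax using hm
  obtain ⟨p, hpF, -, -, h1, h2⟩ := hjump (fun h => (M.P h).getVert (m h - c))
    (fun h => (M.P h).getVert (m h)) (by
      intro h
      have := hml h
      simp only [SimpleGraph.Walk.getVert_mem_support, true_and]
      rw [M.idx_getVert h _ (by omega), M.idx_getVert h _ (by omega)]
      omega)
  have hreach : ∃ n, M.GReach c F n p := by
    rcases h1 with h1 | ⟨h, hs, hlt⟩
    · exact ⟨0, hpF, h1⟩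
    · have := hml h
      rw [M.idx_getVert h _ (by omega)] at hlt
      obtain ⟨n, q, hq, hqs, hqm⟩ := hm0 h (by omega)
      exact ⟨n + 1, hpF, q, hq, h, hqs, hs, by omega⟩
  obtain ⟨n, hn⟩ := hreach
  rcases h2 with h2 | ⟨h, hs, hlt⟩
  · exact hcon n p hn h2
  · rw [M.idx_getVert h _ (hml h)] at hlt
    have := hmax h n p hn hs
    omega

theorem reach_seq (c : ℕ) (F : Set (V × V)) (n : ℕ) (p : V × V) (hp : M.GReach c F n p) :
    ∃ f : ℕ → V × V, f n = p ∧ (∀ i ≤ n, M.GReach c F i (f i)) ∧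
      ∀ i < n, ∃ h, (f i).2 ∈ (M.P h).support ∧ (f (i + 1)).1 ∈ (M.P h).support ∧
        M.idx h (f (i + 1)).1 + c + 1 ≤ M.idx h (f i).2 := by
  induction n generalizing p with
  | zero =>
    refine ⟨fun _ => p, rfl, ?_, ?_⟩
    · intro i hi
      obtain rfl : i = 0 := by omega
      exact hp
    · intro i hi; omega
  | succ n ih =>
    obtain ⟨hpF, q, hq, hstep⟩ := id hp
    obtain ⟨f, hf, hr, hs⟩ := ih q hq
    refine ⟨fun i => if i = n + 1 then p else f i, by simp, ?_, ?_⟩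
    · intro i hi
      by_cases h : i = n + 1
      · subst h; simpa using hp
      · simp only [h, if_false]; exact hr i (by omega)
    · intro i hi
      have h1 : i ≠ n + 1 := by omega
      simp only [h1, if_false]
      by_cases h : i = n
      · subst h; simpa [hf] using hstep
      · have h2 : i + 1 ≠ n + 1 := by omega
        simp only [h2, if_false]
        exact hs i (by omega)

theorem exists_seq (c : ℕ) (F : Set (V × V)) (hjump : M.Jumping c F) :
    ∃ (n : ℕ) (f : ℕ → V × V), (∀ i ≤ n, f i ∈ F) ∧ (f 0).1 ∈ M.S \ M.VP ∧
      (f n).2 ∈ M.T \ M.VP ∧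
      (∀ i < n, ∃ h, (f i).2 ∈ (M.P h).support ∧ (f (i + 1)).1 ∈ (M.P h).support ∧
        M.idx h (f (i + 1)).1 + c + 1 ≤ M.idx h (f i).2) ∧
      (∀ i j, i + 2 ≤ j → j ≤ n → ∀ h, (f i).2 ∈ (M.P h).support →
        (f j).1 ∈ (M.P h).support → M.idx h (f i).2 ≤ M.idx h (f j).1 + c) ∧
      (∀ i j, i < j → j ≤ n → f i ≠ f j) := by
  classical
  have hex := M.exists_reach c F hjump
  let n := Nat.find hex
  have hmin : ∀ m < n, ∀ p, M.GReach c F m p → p.2 ∉ M.T \ M.VP :=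
    fun m hm p hp hT => Nat.find_min hex hm ⟨p, hp, hT⟩
  obtain ⟨p, hp, hpT⟩ := Nat.find_spec hex
  change M.GReach c F n p at hp
  obtain ⟨f, hfn, hr, hs⟩ := M.reach_seq c F n p hp
  have hF : ∀ i ≤ n, f i ∈ F := by
    intro i hi
    have := hr i hi
    cases i with
    | zero => exact this.1
    | succ i => exact this.1
  have hprop : ∀ d j m, j + d = n → M.GReach c F m (f j) → M.GReach c F (m + d) (f n) := by
    intro d
    induction d with
    | zero => intro j m hj hm; obtain rfl : j = n := by omega
              exact hm
    | succ d ih =>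
      intro j m hj hm
      have := ih (j + 1) (m + 1) (by omega) ⟨hF _ (by omega), f j, hm, hs j (by omega)⟩
      rwa [show m + (d + 1) = m + 1 + d by omega]
  have hlev : ∀ j m, j ≤ n → M.GReach c F m (f j) → j ≤ m := by
    intro j m hj hm
    by_contra hlt
    have := hprop (n - j) j m (by omega) hm
    exact hmin _ (by omega) _ this (hfn ▸ hpT)
  refine ⟨n, f, hF, (hr 0 (Nat.zero_le _)).2, hfn ▸ hpT, hs, ?_, ?_⟩
  · intro i j hij hj h hb ha
    by_contra hlt
    have : M.GReach c F (i + 1) (f j) :=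
      ⟨hF j hj, f i, hr i (by omega), h, hb, ha, by omega⟩
    have := hlev j _ hj this
    omega
  · intro i j hij hj heq
    have h1 := hr i (by omega)
    rw [heq] at h1
    have := hlev j i hj h1
    omega

end Setting

namespace Setting

variable {V : Type} [DecidableEq V] {k : ℕ} (M : Setting V k)

/-- Entrance vertices of the pieces. -/
def gEnt (f : ℕ → V × V) (n : ℕ) : Option (Fin k) ⊕ Fin (n + 1) → V
  | .inl none => (f 0).1
  | .inl (some h) => M.sv h
  | .inr i => (f i).2

/-- Rank of a piece. -/
def gLo {k : ℕ} (n : ℕ) : Option (Fin k) ⊕ Fin (n + 1) → ℕ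
  | .inl _ => 0
  | .inr i => i + 1

/-- The piece `e` is left at `(f j).1`. -/
def gNx (f : ℕ → V × V) (n : ℕ) (e : Option (Fin k) ⊕ Fin (n + 1)) (j : ℕ) : Prop :=
  (e = .inl none ∧ j = 0) ∨ ∃ h, M.gEnt f n e ∈ (M.P h).support ∧ (f j).1 ∈ (M.P h).support ∧
    gLo n e < j ∧ ∀ j', gLo n e < j' → j' < j → (f j').1 ∉ (M.P h).support

/-- The index of the exit of the piece `e` in `P h`. -/
def gEx (f : ℕ → V × V) (n : ℕ) (e : Option (Fin k) ⊕ Fin (n + 1)) (h : Fin k) (x : ℕ) : Prop :=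
  (∃ j ≤ n, M.gNx f n e j ∧ (f j).1 ∈ (M.P h).support ∧ x = M.idx h (f j).1) ∨
  ((¬ ∃ j ≤ n, M.gNx f n e j) ∧ x = M.idx h (M.tv h))

/-- The vertices of the piece `e`. -/
def gPiece (f : ℕ → V × V) (n : ℕ) (e : Option (Fin k) ⊕ Fin (n + 1)) : Set V :=
  {v | v = M.gEnt f n e ∨ ∃ h, M.gEnt f n e ∈ (M.P h).support ∧ v ∈ (M.P h).support ∧
    ∃ x, M.gEx f n e h x ∧ min (M.idx h (M.gEnt f n e)) x ≤ M.idx h v ∧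
      M.idx h v ≤ max (M.idx h (M.gEnt f n e)) x}

/-- The successor relation on pieces. -/
def gR (f : ℕ → V × V) (n : ℕ) (e e' : Option (Fin k) ⊕ Fin (n + 1)) : Prop :=
  ∃ j : Fin (n + 1), e' = .inr j ∧ M.gNx f n e j

/-- The properties of the augmenting sequence that we use. -/
structure GSeq (c n : ℕ) (F : Set (V × V)) (f : ℕ → V × V) : Prop where
  memF : ∀ i ≤ n, f i ∈ F
  first : (f 0).1 ∈ M.S \ M.VP
  last : (f n).2 ∈ M.T \ M.VP
  seg : ∀ i < n, ∃ h, (f i).2 ∈ (M.P h).support ∧ (f (i + 1)).1 ∈ (M.P h).support ∧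
        M.idx h (f (i + 1)).1 + c + 1 ≤ M.idx h (f i).2
  far : ∀ i j, i + 2 ≤ j → j ≤ n → ∀ h, (f i).2 ∈ (M.P h).support →
        (f j).1 ∈ (M.P h).support → M.idx h (f i).2 ≤ M.idx h (f j).1 + c
  ne : ∀ i j, i < j → j ≤ n → f i ≠ f j

variable {M} {c n : ℕ} {F : Set (V × V)} {f : ℕ → V × V}

theorem GSeq.seg_b (q : M.GSeq c n F f) {i : ℕ} (hi : i ≤ n) {h : Fin k}
    (hb : (f i).2 ∈ (M.P h).support) : i < n ∧ (f (i + 1)).1 ∈ (M.P h).support ∧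
      M.idx h (f (i + 1)).1 + c + 1 ≤ M.idx h (f i).2 := by
  have hlt : i < n := by
    rcases Nat.lt_or_ge i n with h1 | h1
    · exact h1
    · obtain rfl : i = n := by omega
      exact absurd ⟨h, hb⟩ q.last.2
  obtain ⟨h', h1, h2, h3⟩ := q.seg i hlt
  obtain rfl := M.uniq hb h1
  exact ⟨hlt, h2, h3⟩

theorem GSeq.seg_a (q : M.GSeq c n F f) {i : ℕ} (hi : i ≤ n) {h : Fin k}
    (ha : (f i).1 ∈ (M.P h).support) : ∃ i', i = i' + 1 ∧ (f i').2 ∈ (M.P h).support ∧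
      M.idx h (f i).1 + c + 1 ≤ M.idx h (f i').2 := by
  cases i with
  | zero => exact absurd ⟨h, ha⟩ q.first.2
  | succ i =>
    obtain ⟨h', h1, h2, h3⟩ := q.seg i (by omega)
    obtain rfl := M.uniq ha h2
    exact ⟨i, rfl, h1, h3⟩

theorem GSeq.bb (q : M.GSeq c n F f) (hsep : M.Separated (2 * c) F) {i j : ℕ} (hij : i < j)
    (hj : j ≤ n) {h : Fin k} (hi' : (f i).2 ∈ (M.P h).support)
    (hj' : (f j).2 ∈ (M.P h).support) : M.idx h (f i).2 + 2 * c < M.idx h (f j).2 := by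
  obtain ⟨h1, h2, h3⟩ := q.seg_b hj hj'
  have h4 := q.far i (j + 1) (by omega) (by omega) h hi' h2
  exact M.pdist_far h hi' hj' (2 * c)
    (hsep _ (q.memF i (by omega)) _ (q.memF j hj) (q.ne i j hij hj)).2 (by omega)

theorem GSeq.aa (q : M.GSeq c n F f) (hsep : M.Separated (2 * c) F) {i j : ℕ} (hij : i < j)
    (hj : j ≤ n) {h : Fin k} (hi' : (f i).1 ∈ (M.P h).support)
    (hj' : (f j).1 ∈ (M.P h).support) : M.idx h (f i).1 + 2 * c < M.idx h (f j).1 := by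
  obtain ⟨i', rfl, h2, h3⟩ := q.seg_a (by omega) hi'
  have h4 := q.far i' j (by omega) (by omega) h h2 hj'
  exact M.pdist_far h hi' hj' (2 * c)
    (hsep _ (q.memF _ (by omega)) _ (q.memF j hj) (q.ne _ j hij hj)).1 (by omega)

/-- Existence of the next exit. -/
theorem GSeq.next (q : M.GSeq c n F f) {e : Option (Fin k) ⊕ Fin (n + 1)} {h : Fin k}
    (he : M.gEnt f n e ∈ (M.P h).support) {r : ℕ} (hr : gLo n e < r) (hrn : r ≤ n)
    (ha : (f r).1 ∈ (M.P h).support) :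
    ∃ j ≤ r, M.gNx f n e j := by
  classical
  have hex : ∃ j, gLo n e < j ∧ (f j).1 ∈ (M.P h).support := ⟨r, hr, ha⟩
  refine ⟨Nat.find hex, Nat.find_min' hex ⟨hr, ha⟩, Or.inr ⟨h, he, (Nat.find_spec hex).2,
    (Nat.find_spec hex).1, ?_⟩⟩
  intro j' h1 h2 h3
  exact Nat.find_min hex h2 ⟨h1, h3⟩

theorem GSeq.none_off (q : M.GSeq c n F f) {e : Option (Fin k) ⊕ Fin (n + 1)} {h : Fin k}
    (he : M.gEnt f n e ∈ (M.P h).support) : e ≠ .inl none := by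
  rintro rfl
  exact q.first.2 ⟨h, he⟩

theorem GSeq.nx_on (q : M.GSeq c n F f) {e : Option (Fin k) ⊕ Fin (n + 1)} {h : Fin k}
    (he : M.gEnt f n e ∈ (M.P h).support) {j : ℕ} (hj : M.gNx f n e j) :
    (f j).1 ∈ (M.P h).support ∧ gLo n e < j ∧
      ∀ j', gLo n e < j' → j' < j → (f j').1 ∉ (M.P h).support := by
  rcases hj with ⟨h1, -⟩ | ⟨h', h1, h2⟩
  · exact absurd h1 (q.none_off he)
  · obtain rfl := M.uniq he h1
    exact h2

theorem GSeq.nx_uniq (q : M.GSeq c n F f) {e : Option (Fin k) ⊕ Fin (n + 1)} {h : Fin k}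
    (he : M.gEnt f n e ∈ (M.P h).support) {j j' : ℕ} (hj : M.gNx f n e j)
    (hj' : M.gNx f n e j') : j = j' := by
  have h1 := q.nx_on he hj
  have h2 := q.nx_on he hj'
  rcases lt_trichotomy j j' with h | h | h
  · exact absurd h1.1 (h2.2.2 j h1.2.1 h)
  · exact h
  · exact absurd h2.1 (h1.2.2 j' h2.2.1 h)

theorem lo_eq {e e' : Option (Fin k) ⊕ Fin (n + 1)} {h : Fin k}
    (q : M.GSeq c n F f) (he : M.gEnt f n e ∈ (M.P h).support)
    (he' : M.gEnt f n e' ∈ (M.P h).support) (hlo : gLo n e = gLo n e') : e = e' := by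
  rcases e with (_ | a) | i <;> rcases e' with (_ | b) | j
  · rfl
  · exact absurd rfl (q.none_off he)
  · exact absurd rfl (q.none_off he)
  · exact absurd rfl (q.none_off he')
  · have h1 := M.uniq he (M.P a).start_mem_support
    have h2 := M.uniq he' (M.P b).start_mem_support
    rw [← h1, ← h2]
  · simp [gLo] at hlo
  · simp [gLo] at hlo
  · simp [gLo] at hlo
  · simp only [gLo] at hlo
    congr 1
    ext
    omega

/-- A piece of positive rank has entrance `(f i).2`. -/
theorem GSeq.rank_pos (q : M.GSeq c n F f) {e : Option (Fin k) ⊕ Fin (n + 1)} {h : Fin k}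
    (he : M.gEnt f n e ∈ (M.P h).support) (hlo : 0 < gLo n e) :
    ∃ i, i < n ∧ gLo n e = i + 1 ∧ M.gEnt f n e = (f i).2 ∧ (f i).2 ∈ (M.P h).support ∧
      (f (i + 1)).1 ∈ (M.P h).support ∧ M.idx h (f (i + 1)).1 + c + 1 ≤ M.idx h (f i).2 := by
  rcases e with a | i
  · simp [gLo] at hlo
  · have := q.seg_b (by omega) he
    exact ⟨i, this.1, rfl, rfl, he, this.2⟩

theorem GSeq.rank_zero (q : M.GSeq c n F f) {e : Option (Fin k) ⊕ Fin (n + 1)} {h : Fin k}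
    (he : M.gEnt f n e ∈ (M.P h).support) (hlo : gLo n e = 0) :
    M.idx h (M.gEnt f n e) = 0 := by
  rcases e with (_ | a) | i
  · exact absurd rfl (q.none_off he)
  · obtain rfl := M.uniq he (M.P a).start_mem_support
    exact M.idx_sv h
  · simp [gLo] at hlo

theorem GSeq.bounds (q : M.GSeq c n F f) (hsep : M.Separated (2 * c) F)
    {e e' : Option (Fin k) ⊕ Fin (n + 1)} {h : Fin k}
    (he : M.gEnt f n e ∈ (M.P h).support) (he' : M.gEnt f n e' ∈ (M.P h).support)
    (hlo : gLo n e < gLo n e') {x x' : ℕ} (hx : M.gEx f n e h x) (hx' : M.gEx f n e' h x') :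
    M.idx h (M.gEnt f n e) + c < M.idx h (M.gEnt f n e') ∧ M.idx h (M.gEnt f n e) + c < x' ∧
      x + c < M.idx h (M.gEnt f n e') ∧ x + c < x' := by
  obtain ⟨i', hi', hlo', hent', hb', ha', hgap'⟩ := q.rank_pos he' (by omega)
  rw [hent']
  obtain ⟨j, hjr, hj⟩ := q.next he (r := i' + 1) (by omega) (by omega) ha'
  obtain ⟨hja, hjlo, -⟩ := q.nx_on he hj
  have hxj : x = M.idx h (f j).1 := by
    rcases hx with ⟨j2, h1, h2, h3, h4⟩ | ⟨h1, -⟩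
    · rw [h4, q.nx_uniq he hj h2]
    · exact absurd ⟨j, by omega, hj⟩ h1
  obtain ⟨j0, rfl, hj0b, hj0gap⟩ := q.seg_a (by omega) hja
  have A1 : M.idx h (f j0).2 ≤ M.idx h (f i').2 := by
    rcases Nat.lt_or_ge j0 i' with h1 | h1
    · have := q.bb hsep h1 (by omega) hj0b hb'
      omega
    · obtain rfl : j0 = i' := by omega
      exact le_rfl
  have A2 : M.idx h (M.gEnt f n e) + 2 * c < M.idx h (f i').2 ∨
      M.idx h (M.gEnt f n e) = 0 := by
    rcases Nat.eq_zero_or_pos (gLo n e) with h0 | h0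
    · exact Or.inr (q.rank_zero he h0)
    · obtain ⟨i, hi, hloi, hent, hb, ha, hgap⟩ := q.rank_pos he h0
      left
      rw [hent]
      exact q.bb hsep (by omega) (by omega) hb hb'
  have A3 : M.idx h (M.gEnt f n e) ≤ x + c := by
    rcases Nat.eq_zero_or_pos (gLo n e) with h0 | h0
    · rw [q.rank_zero he h0]; omega
    · obtain ⟨i, hi, hloi, hent, hb, ha, hgap⟩ := q.rank_pos he h0
      rw [hent, hxj]
      exact q.far i _ (by omega) (by omega) h hb hja
  have A4 : x + 2 * c < x' ∨ M.idx h (f i').2 ≤ x' := by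
    rcases hx' with ⟨j2, h1, h2, h3, h4⟩ | ⟨-, h4⟩
    · left
      obtain ⟨_, h5, -⟩ := q.nx_on he' h2
      rw [hxj, h4]
      exact q.aa hsep (by omega) h1 hja h3
    · right
      rw [h4, M.idx_tv]
      exact M.idx_le h hb'
  omega

theorem GSeq.ex_exists (q : M.GSeq c n F f) {e : Option (Fin k) ⊕ Fin (n + 1)} {h : Fin k}
    (he : M.gEnt f n e ∈ (M.P h).support) : ∃ x, M.gEx f n e h x := by
  by_cases hex : ∃ j ≤ n, M.gNx f n e j
  · obtain ⟨j, hj, hn⟩ := hex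
    exact ⟨_, Or.inl ⟨j, hj, hn, (q.nx_on he hn).1, rfl⟩⟩
  · exact ⟨_, Or.inr ⟨hex, rfl⟩⟩

theorem GSeq.piece_on (q : M.GSeq c n F f) {e : Option (Fin k) ⊕ Fin (n + 1)} {h : Fin k}
    {v : V} (hv : v ∈ M.gPiece f n e) (hvh : v ∈ (M.P h).support) :
    M.gEnt f n e ∈ (M.P h).support ∧
    ∃ x, M.gEx f n e h x ∧ min (M.idx h (M.gEnt f n e)) x ≤ M.idx h v ∧
      M.idx h v ≤ max (M.idx h (M.gEnt f n e)) x := by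
  rcases hv with rfl | ⟨h', h1, h2, h3⟩
  · obtain ⟨x, hx⟩ := q.ex_exists hvh
    exact ⟨hvh, x, hx, by omega, by omega⟩
  · obtain rfl := M.uniq hvh h2
    exact ⟨h1, h3⟩

theorem GSeq.sep_lt (q : M.GSeq c n F f) (hsep : M.Separated (2 * c) F)
    {e e' : Option (Fin k) ⊕ Fin (n + 1)} {h : Fin k} {u v : V} (hu : u ∈ M.gPiece f n e)
    (hv : v ∈ M.gPiece f n e') (huh : u ∈ (M.P h).support) (hvh : v ∈ (M.P h).support)
    (hlo : gLo n e < gLo n e') : M.idx h u + c < M.idx h v := by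
  obtain ⟨he, x, hx, hx1, hx2⟩ := q.piece_on hu huh
  obtain ⟨he', x', hx', hx1', hx2'⟩ := q.piece_on hv hvh
  have := q.bounds hsep he he' hlo hx hx'
  omega

theorem GSeq.off (q : M.GSeq c n F f) {e : Option (Fin k) ⊕ Fin (n + 1)} {v : V}
    (hv : v ∈ M.gPiece f n e) (hoff : v ∉ M.VP) : v = M.gEnt f n e ∧
    (e = .inl none ∨ e = .inr (Fin.last n)) := by
  have h1 : v = M.gEnt f n e := by
    rcases hv with h | ⟨h, -, h2, -⟩
    · exact h
    · exact absurd ⟨h, h2⟩ hoff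
  refine ⟨h1, ?_⟩
  rcases e with (_ | a) | i
  · exact Or.inl rfl
  · refine absurd ⟨a, ?_⟩ hoff
    rw [h1]
    exact (M.P a).start_mem_support
  · right
    congr 1
    by_contra hne
    have hlt : (i : ℕ) < n := by
      have := Fin.val_lt_last hne
      exact this
    obtain ⟨h, hb, -⟩ := q.seg i hlt
    exact hoff ⟨h, h1 ▸ hb⟩

theorem GSeq.sep (q : M.GSeq c n F f) (hsep : M.Separated (2 * c) F)
    (e e' : Option (Fin k) ⊕ Fin (n + 1)) (hne : e ≠ e') (u : V) (hu : u ∈ M.gPiece f n e)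
    (v : V) (hv : v ∈ M.gPiece f n e') (w : M.UP.Walk u v) : c < w.length := by
  have hST : (f 0).1 ≠ (f n).2 := fun h =>
    Set.disjoint_left.mp M.disjST q.first.1 (h ▸ q.last.1)
  by_cases huV : u ∈ M.VP
  · obtain ⟨h, huh⟩ := huV
    obtain ⟨hvh, h1, h2⟩ := M.UP_walk_on w huh
    rcases lt_trichotomy (gLo n e) (gLo n e') with hlo | hlo | hlo
    · have := q.sep_lt hsep hu hv huh hvh hlo
      omega
    · exact absurd (lo_eq q (q.piece_on hu huh).1 (q.piece_on hv hvh).1 hlo) hne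
    · have := q.sep_lt hsep hv hu hvh huh hlo
      omega
  · have hvu := M.UP_walk_off w huV
    exfalso
    obtain ⟨h1, h2⟩ := q.off hu huV
    obtain ⟨h3, h4⟩ := q.off hv (hvu ▸ huV)
    have h5 : M.gEnt f n e = M.gEnt f n e' := by rw [← h1, ← h3, hvu]
    rcases h2 with rfl | rfl <;> rcases h4 with rfl | rfl
    · exact hne rfl
    · exact hST h5
    · exact hST h5.symm
    · exact hne rfl

theorem GSeq.left_unique (q : M.GSeq c n F f) (a b x : Option (Fin k) ⊕ Fin (n + 1))
    (ha : M.gR f n a x) (hb : M.gR f n b x) : a = b := by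
  obtain ⟨j, rfl, ha⟩ := ha
  obtain ⟨j', hjj, hb⟩ := hb
  obtain rfl : j = j' := Sum.inr.inj hjj
  rcases ha with ⟨rfl, h0⟩ | ⟨h, a1, a2, a3, a4⟩
  · rcases hb with ⟨rfl, _⟩ | ⟨h, b1, b2, b3, b4⟩
    · rfl
    · omega
  · rcases hb with ⟨rfl, _⟩ | ⟨h', b1, b2, b3, b4⟩
    · omega
    · obtain rfl := M.uniq a2 b2
      have key : ∀ e e' : Option (Fin k) ⊕ Fin (n + 1), M.gEnt f n e' ∈ (M.P h).support →
          gLo n e' < j → (∀ j', gLo n e < j' → j' < (j : ℕ) → (f j').1 ∉ (M.P h).support) →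
          ¬ gLo n e < gLo n e' := by
        intro e e' he' h1 h2 hlt
        obtain ⟨i, hi, hlo, -, -, h3, -⟩ := q.rank_pos he' (by omega)
        exact h2 (i + 1) (by omega) (by omega) h3
      have k1 := key a b b1 b3 a4
      have k2 := key b a a1 a3 b4
      exact lo_eq q a1 b1 (by omega)

end Setting

/-- If `F` is `c`-jumping and `2c`-separated, then the graph `H` obtained from `U𝒫` by
adding the vertices of `(S ∪ T) \ V𝒫` and the pairs of `F` as edges contains `k+1`
pairwise vertex-disjoint `S`–`T` paths, no two of which are joined by a path of `U𝒫` of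
length at most `c`. -/
theorem get_paths (V : Type) [Fintype V] [DecidableEq V] (k : ℕ)
    (M : Setting V k) (c : ℕ) (F : Set (V × V)) (hF : F ⊆ M.F0)
    (hjump : M.Jumping c F) (hsep : M.Separated (2 * c) F) :
    ∃ (u v : Fin (k + 1) → V)
      (Z : ∀ i, (M.UP ⊔ SimpleGraph.fromEdgeSet {e : Sym2 V | ∃ p ∈ F, e = s(p.1, p.2)}).Walk
        (u i) (v i)),
      (∀ i, (Z i).IsPath) ∧ (∀ i, u i ∈ M.S) ∧ (∀ i, v i ∈ M.T) ∧
      (∀ i j, i ≠ j → ∀ x, x ∈ (Z i).support → x ∉ (Z j).support) ∧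
      (∀ i j, i ≠ j →
        (c : ℕ∞) < eSetDist M.UP {x | x ∈ (Z i).support} {x | x ∈ (Z j).support}) := by
  obtain ⟨n, f, h1, h2, h3, h4, h5, h6⟩ := M.exists_seq c F hjump
  have q : M.GSeq c n F f := ⟨h1, h2, h3, h4, h5, h6⟩
  have hle : M.UP ≤ M.UP ⊔ SimpleGraph.fromEdgeSet {e : Sym2 V | ∃ p ∈ F, e = s(p.1, p.2)} :=
    le_sup_left
  have hedge : ∀ j ≤ n, (M.UP ⊔ SimpleGraph.fromEdgeSet
      {e : Sym2 V | ∃ p ∈ F, e = s(p.1, p.2)}).Adj (f j).1 (f j).2 := by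
    intro j hj
    rw [SimpleGraph.sup_adj]
    right
    rw [SimpleGraph.fromEdgeSet_adj]
    exact ⟨⟨f j, h1 j hj, rfl⟩, (hF (h1 j hj)).1⟩
  have hent : ∀ e, M.gEnt f n e ∈ M.gPiece f n e := fun e => Or.inl rfl
  refine gp_assemble M.UP _ c M.S M.T (M.gR f n) (M.gPiece f n) (M.gEnt f n) k
    (fun i => .inl (finSuccEquiv k i)) ?_ q.left_unique ?_ ?_ hent ?_ ?_ (q.sep hsep)
  · intro a b hab
    exact (finSuccEquiv k).injective (Sum.inl.inj hab)
  · rintro i a ⟨j, hj, -⟩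
    cases hj
  · intro i
    rcases hcase : finSuccEquiv k i with _ | h
    · exact h2.1
    · exact M.sv_mem h
  · rintro e _ ⟨j, rfl, hnx⟩
    have hj : (j : ℕ) ≤ n := by omega
    rcases id hnx with ⟨rfl, h0⟩ | ⟨h, a1, a2, -⟩
    · have := hedge j hj
      rw [h0] at this
      have e1 : M.gEnt f n (.inr j) = (f 0).2 := by simp only [Setting.gEnt, h0]
      have e2 : M.gEnt f n (.inl none) = (f 0).1 := rfl
      rw [e1, e2]
      refine ⟨SimpleGraph.Walk.cons this .nil, ?_⟩
      intro x hx
      simp at hx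
      rcases hx with rfl | rfl
      · exact Or.inl (Or.inl rfl)
      · exact Or.inr (Or.inl e1.symm)
    · obtain ⟨w, hw⟩ := M.UP_walk h a1 a2
      have e1 : M.gEnt f n (.inr j) = (f j).2 := rfl
      rw [e1]
      refine ⟨(w.mapLe hle).concat (hedge j hj), ?_⟩
      intro x hx
      rw [SimpleGraph.Walk.support_concat] at hx
      simp at hx
      rcases hx with hx | rfl
      · left
        obtain ⟨b1, b2⟩ := hw x hx
        exact Or.inr ⟨h, a1, b1, _, Or.inl ⟨j, hj, hnx, a2, rfl⟩, b2⟩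
      · exact Or.inr (Or.inl rfl)
  · intro e hno
    have hno' : ¬ ∃ j ≤ n, M.gNx f n e j := by
      rintro ⟨j, hj, hnx⟩
      exact hno _ ⟨⟨j, by omega⟩, rfl, hnx⟩
    by_cases hV : M.gEnt f n e ∈ M.VP
    · obtain ⟨h, hh⟩ := hV
      obtain ⟨w, hw⟩ := M.UP_walk h hh (M.P h).end_mem_support
      refine ⟨M.tv h, M.tv_mem h, w.mapLe hle, ?_⟩
      intro x hx
      simp at hx
      obtain ⟨b1, b2⟩ := hw x hx
      exact Or.inr ⟨h, hh, b1, _, Or.inr ⟨hno', rfl⟩, b2⟩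
    · rcases (q.off (hent e) hV).2 with rfl | rfl
      · exact absurd ⟨0, Nat.zero_le _, Or.inl ⟨rfl, rfl⟩⟩ hno'
      · have e1 : M.gEnt f n (.inr (Fin.last n)) ∈ M.T := h3.1
        refine ⟨_, e1, .nil, ?_⟩
        intro x hx
        simp at hx
        exact Or.inl hx
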